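/- arXiv:1008.3581 — 2 statements merged into one kernel-verified Lean document; each statement's English description precedes it below -/
import Mathlib

section
/- For every p with 3 < p ≤ ∞ there is a constant C_p > 0 such that for all ε ∈ (0,1], all t > 0 and all g ∈ L¹(ℝ³): the convolution √ε · (G_ε(|·|,t) * g) satisfies ‖ √ε · (G_ε(|·|,t) * g) ‖_{L^p(ℝ³)} ≤ C_p · t^{-m} (1+t)^{-m-min(m,1/4)} ‖g‖_{L¹(ℝ³)}, where m = 1/2 − 3/(2p). The constant C_p is independent of ε, t and g. -/
open MeasureTheory

/-- The Green's function kernel `G_ε(r,t)` of `(−Δ − z)^{-1} e^{itΔ}` on `ℝ³`,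
with `z = 1/4 + iε`. -/
noncomputable def Gker (ε r t : ℝ) : ℂ :=
  (Complex.exp (-(Real.pi / 4 : ℝ) * Complex.I) / ((8 * Real.pi ^ ((3 : ℝ) / 2) : ℝ))) *
    ∫ s in Set.Ioi t,
      Complex.exp (Complex.I * (((s : ℂ) - (t : ℂ)) * (1 / 4 + (ε : ℂ) * Complex.I)
          + (r : ℂ) ^ 2 / (4 * (s : ℂ)))) * ((s ^ (-(3 : ℝ) / 2) : ℝ) : ℂ)

/-- The decay exponent `m = 1/2 − 3/(2p)` (for `p = ∞`, `p.toReal = 0` and `3/0 = 0`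
in Lean, so `m = 1/2`, as desired). -/
noncomputable def mExp (p : ENNReal) : ℝ := 1 / 2 - 3 / (2 * p.toReal)

theorem norm_integral_mul_deriv_le_of_antitone {α β K : ℝ} (hαβ : α ≤ β) {b b' : ℝ → ℝ}
    {F F' : ℝ → ℂ} (hb : ∀ s ∈ Set.Icc α β, HasDerivAt b (b' s) s)
    (hF : ∀ s ∈ Set.Icc α β, HasDerivAt F (F' s) s)
    (hb'c : ContinuousOn b' (Set.Icc α β)) (hF'c : ContinuousOn F' (Set.Icc α β))
    (hb' : ∀ s ∈ Set.Icc α β, b' s ≤ 0) (hb0 : ∀ s ∈ Set.Icc α β, 0 ≤ b s)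
    (hK : ∀ s ∈ Set.Icc α β, ‖F s‖ ≤ K) :
    ‖∫ s in α..β, (b s : ℂ) * F' s‖ ≤ 2 * K * b α := by
  have hu : Set.uIcc α β = Set.Icc α β := Set.uIcc_of_le hαβ
  have hα := Set.left_mem_Icc.2 hαβ
  have hβ := Set.right_mem_Icc.2 hαβ
  have hibp := intervalIntegral.integral_mul_deriv_eq_deriv_mul (a := α) (b := β)
    (u := fun s => (b s : ℂ)) (u' := fun s => (b' s : ℂ)) (v := F) (v' := F')
    (fun s hs => (hb s (hu ▸ hs)).ofReal_comp) (fun s hs => hF s (hu ▸ hs))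
    (ContinuousOn.intervalIntegrable
      (by rw [hu]; exact Complex.continuous_ofReal.comp_continuousOn hb'c))
    (ContinuousOn.intervalIntegrable (by rwa [hu]))
  have hint : ∫ s in α..β, b' s = b β - b α :=
    intervalIntegral.integral_eq_sub_of_hasDerivAt (fun s hs => hb s (hu ▸ hs))
      (ContinuousOn.intervalIntegrable (by rwa [hu]))
  have hrem : ‖∫ s in α..β, (b' s : ℂ) * F s‖ ≤ ∫ s in α..β, -K * b' s := by
    refine intervalIntegral.norm_integral_le_of_norm_le hαβ
      (Filter.Eventually.of_forall fun s hs => ?_)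
      (ContinuousOn.intervalIntegrable (by rw [hu]; exact continuousOn_const.mul hb'c))
    have hs' := Set.Ioc_subset_Icc_self hs
    rw [norm_mul, Complex.norm_real, Real.norm_eq_abs, abs_of_nonpos (hb' s hs')]
    nlinarith [hK s hs', hb' s hs']
  rw [intervalIntegral.integral_const_mul, hint] at hrem
  have h1 : ‖(b β : ℂ) * F β‖ ≤ b β * K := by
    rw [norm_mul, Complex.norm_real, Real.norm_eq_abs, abs_of_nonneg (hb0 β hβ)]
    exact mul_le_mul_of_nonneg_left (hK β hβ) (hb0 β hβ)
  have h2 : ‖(b α : ℂ) * F α‖ ≤ b α * K := by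
    rw [norm_mul, Complex.norm_real, Real.norm_eq_abs, abs_of_nonneg (hb0 α hα)]
    exact mul_le_mul_of_nonneg_left (hK α hα) (hb0 α hα)
  rw [hibp]
  have h3 := norm_sub_le ((b β : ℂ) * F β - b α * F α) (∫ s in α..β, (b' s : ℂ) * F s)
  have h4 := norm_sub_le ((b β : ℂ) * F β) (b α * F α)
  linarith

/-- The Fresnel integral `∫₀^y exp(iu²) du`. -/
noncomputable def fresnel (y : ℝ) : ℂ := ∫ u in (0 : ℝ)..y, Complex.exp (Complex.I * (u : ℂ) ^ 2)

theorem continuous_exp_I_mul_sq :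
    Continuous fun u : ℝ => Complex.exp (Complex.I * (u : ℂ) ^ 2) := by
  fun_prop

theorem norm_exp_I_mul_sq (u : ℝ) : ‖Complex.exp (Complex.I * (u : ℂ) ^ 2)‖ = 1 := by
  rw [← Complex.ofReal_pow, mul_comm, Complex.norm_exp_ofReal_mul_I]

theorem hasDerivAt_fresnel (y : ℝ) :
    HasDerivAt fresnel (Complex.exp (Complex.I * (y : ℂ) ^ 2)) y :=
  continuous_exp_I_mul_sq.integral_hasStrictDerivAt 0 y |>.hasDerivAt

theorem fresnel_sub (x y : ℝ) :
    fresnel y - fresnel x = ∫ u in x..y, Complex.exp (Complex.I * (u : ℂ) ^ 2) :=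
  intervalIntegral.integral_interval_sub_left (continuous_exp_I_mul_sq.intervalIntegrable _ _)
    (continuous_exp_I_mul_sq.intervalIntegrable _ _)

theorem fresnel_neg (y : ℝ) : fresnel (-y) = -fresnel y := by
  have h := intervalIntegral.integral_comp_neg (a := 0) (b := y)
    (fun u : ℝ => Complex.exp (Complex.I * (u : ℂ) ^ 2))
  simp only [Complex.ofReal_neg, even_two, Even.neg_pow, neg_zero] at h
  rw [fresnel, fresnel, h, intervalIntegral.integral_symm]

theorem norm_fresnel_sub_le {x y : ℝ} (hx : 0 < x) (hxy : x ≤ y) :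
    ‖fresnel y - fresnel x‖ ≤ x⁻¹ := by
  have hpos : ∀ s ∈ Set.Icc x y, 0 < s := fun s hs => hx.trans_le hs.1
  have h := norm_integral_mul_deriv_le_of_antitone hxy (K := 1) (b := fun s => s⁻¹ / 2)
    (b' := fun s => -(s ^ 2)⁻¹ / 2)
    (F := fun s => -Complex.I * Complex.exp (Complex.I * (s : ℂ) ^ 2))
    (F' := fun s => -Complex.I * (Complex.exp (Complex.I * (s : ℂ) ^ 2) *
      (Complex.I * (2 * (s : ℂ)))))
    (fun s hs => (hasDerivAt_inv (hpos s hs).ne').div_const 2)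
    (fun s _ => by
      have h1 : HasDerivAt (fun s : ℝ => (s : ℂ) ^ 2) (2 * (s : ℂ)) s := by
        exact ((hasDerivAt_id s).ofReal_comp.pow 2).congr_deriv (by simp)
      exact ((h1.const_mul Complex.I).cexp).const_mul (-Complex.I))
    (by
      refine ContinuousOn.div_const (ContinuousOn.neg (ContinuousOn.inv₀ (by fun_prop) ?_)) _
      exact fun s hs => (pow_pos (hpos s hs) 2).ne')
    (by fun_prop)
    (fun s _ => by have := sq_nonneg s; have := inv_nonneg.2 this; linarith)
    (fun s hs => by have := hpos s hs; positivity)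
    (fun s _ => by rw [norm_mul, norm_exp_I_mul_sq]; simp)
  rw [fresnel_sub]
  calc _ = _ := by
        congr 1
        refine intervalIntegral.integral_congr fun s hs => ?_
        rw [Set.uIcc_of_le hxy] at hs
        have : (s : ℂ) ≠ 0 := by exact_mod_cast (hpos s hs).ne'
        push_cast
        field_simp
        rw [Complex.I_sq]; ring
    _ ≤ _ := h
    _ = _ := by ring

theorem norm_fresnel_le (y : ℝ) : ‖fresnel y‖ ≤ 2 := by
  wlog hy : 0 ≤ y generalizing y
  · rw [← norm_neg, ← fresnel_neg]; exact this _ (by linarith)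
  have small : ∀ z : ℝ, 0 ≤ z → z ≤ 1 → ‖fresnel z‖ ≤ 1 := fun z hz hz1 => by
    have := intervalIntegral.norm_integral_le_of_norm_le_const (a := 0) (b := z) (C := 1)
      (f := fun u : ℝ => Complex.exp (Complex.I * (u : ℂ) ^ 2))
      (fun u _ => (norm_exp_I_mul_sq u).le)
    rw [sub_zero, abs_of_nonneg hz] at this
    rw [fresnel]; linarith
  rcases le_total y 1 with h | h
  · linarith [small y hy h]
  · have h1 := norm_fresnel_sub_le one_pos h
    have h2 := small 1 zero_le_one le_rfl
    have h3 := norm_add_le (fresnel y - fresnel 1) (fresnel 1)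
    rw [sub_add_cancel] at h3
    norm_num at h1
    linarith

theorem norm_fresnel_sub_le_of_neg {x y : ℝ} (hy : y < 0) (hxy : x ≤ y) :
    ‖fresnel x - fresnel y‖ ≤ (-y)⁻¹ := by
  have h := norm_fresnel_sub_le (neg_pos.2 hy) (neg_le_neg hxy)
  rw [fresnel_neg, fresnel_neg] at h
  rwa [show fresnel x - fresnel y = -(-fresnel x - -fresnel y) by ring, norm_neg]

/-- The integrand of `Gker`. -/
noncomputable def gIntegrand (ε r t s : ℝ) : ℂ :=
  Complex.exp (Complex.I * (((s : ℂ) - (t : ℂ)) * (1 / 4 + (ε : ℂ) * Complex.I)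
    + (r : ℂ) ^ 2 / (4 * (s : ℂ)))) * ((s ^ (-(3 : ℝ) / 2) : ℝ) : ℂ)

/-- The square root of the phase `s / 4 + r ^ 2 / (4 * s) - r / 2`. -/
noncomputable def phaseRoot (r s : ℝ) : ℝ := √s / 2 - r / (2 * √s)

theorem phaseRoot_sq (r : ℝ) {s : ℝ} (hs : 0 < s) :
    phaseRoot r s ^ 2 = s / 4 + r ^ 2 / (4 * s) - r / 2 := by
  have h := Real.sq_sqrt hs.le
  have h0 := Real.sqrt_pos.2 hs
  rw [phaseRoot]
  field_simp
  rw [← h]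
  simp only [Real.sqrt_sq h0.le]
  ring

theorem rpow_neg_three_halves {s : ℝ} (hs : 0 < s) : s ^ (-(3 : ℝ) / 2) = (s * √s)⁻¹ := by
  rw [neg_div, Real.rpow_neg hs.le, Real.sqrt_eq_rpow, ← Real.rpow_one_add' hs.le (by norm_num)]
  norm_num

theorem hasDerivAt_phaseRoot (r : ℝ) {s : ℝ} (hs : 0 < s) :
    HasDerivAt (phaseRoot r) ((s + r) / (4 * (s * √s))) s := by
  have h0 := Real.sqrt_pos.2 hs
  have h1 := (Real.hasDerivAt_sqrt hs.ne')
  have h2 := (h1.div_const 2).sub ((hasDerivAt_const s r).div (h1.const_mul 2) (by positivity))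
  refine h2.congr_deriv ?_
  have h := Real.sq_sqrt hs.le
  field_simp
  rw [h]
  ring

theorem gIntegrand_eq (ε t : ℝ) {r s : ℝ} (hr : 0 ≤ r) (hs : 0 < s) :
    gIntegrand ε r t s = Complex.exp (((r / 2 - t / 4 : ℝ) : ℂ) * Complex.I) *
      (((4 * Real.exp (-ε * (s - t)) / (s + r) : ℝ) : ℂ) *
        (Complex.exp (Complex.I * (phaseRoot r s : ℂ) ^ 2) *
          (((s + r) / (4 * (s * √s)) : ℝ) : ℂ))) := by
  have h0 := Real.sqrt_pos.2 hs
  have e1 : Complex.exp (Complex.I * (((s : ℂ) - (t : ℂ)) * (1 / 4 + (ε : ℂ) * Complex.I)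
      + (r : ℂ) ^ 2 / (4 * (s : ℂ)))) = Complex.exp (((r / 2 - t / 4 : ℝ) : ℂ) * Complex.I) *
      Complex.exp ((-ε * (s - t) : ℝ) : ℂ) * Complex.exp (Complex.I * (phaseRoot r s : ℂ) ^ 2) := by
    rw [← Complex.exp_add, ← Complex.exp_add, ← Complex.ofReal_pow (phaseRoot r s),
      phaseRoot_sq r hs]
    congr 1
    push_cast
    linear_combination ((s : ℂ) - t) * ε * Complex.I_sq
  have e2 : 4 * Real.exp (-ε * (s - t)) / (s + r) * ((s + r) / (4 * (s * √s))) =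
      Real.exp (-ε * (s - t)) * (s * √s)⁻¹ := by
    have : s + r ≠ 0 := by positivity
    field_simp
  have e3 := congrArg (fun x : ℝ => (x : ℂ)) e2
  simp only [Complex.ofReal_mul _ ((s + r) / _), Complex.ofReal_mul _ (s * √s)⁻¹] at e3
  rw [gIntegrand, e1, rpow_neg_three_halves hs, ← Complex.ofReal_exp]
  linear_combination -Complex.exp (((r / 2 - t / 4 : ℝ) : ℂ) * Complex.I) *
    Complex.exp (Complex.I * (phaseRoot r s : ℂ) ^ 2) * e3

theorem norm_intervalIntegral_gIntegrand_le {ε r t α β K : ℝ} (hε : 0 ≤ ε) (hr : 0 ≤ r)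
    (hα : 0 < α) (hαβ : α ≤ β) (c : ℂ)
    (hK : ∀ s ∈ Set.Icc α β, ‖fresnel (phaseRoot r s) - c‖ ≤ K) :
    ‖∫ s in α..β, gIntegrand ε r t s‖ ≤ 8 * K * Real.exp (-ε * (α - t)) / (α + r) := by
  have hpos : ∀ s ∈ Set.Icc α β, 0 < s := fun s hs => hα.trans_le hs.1
  have hexp : ∀ s, HasDerivAt (fun s => 4 * Real.exp (-ε * (s - t)))
      (4 * (Real.exp (-ε * (s - t)) * (-ε * 1))) s := fun s =>
    ((((hasDerivAt_id s).sub_const t).const_mul (-ε)).exp).const_mul 4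
  have h := norm_integral_mul_deriv_le_of_antitone hαβ (K := K)
    (b := fun s => 4 * Real.exp (-ε * (s - t)) / (s + r))
    (b' := fun s => ((4 * (Real.exp (-ε * (s - t)) * (-ε * 1))) * (s + r)
      - 4 * Real.exp (-ε * (s - t)) * 1) / (s + r) ^ 2)
    (F := fun s => fresnel (phaseRoot r s) - c)
    (F' := fun s => Complex.exp (Complex.I * (phaseRoot r s : ℂ) ^ 2) *
          (((s + r) / (4 * (s * √s)) : ℝ) : ℂ))
    (fun s hs => (hexp s).div ((hasDerivAt_id s).add_const r) (by
      have := hpos s hs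
      positivity))
    (fun s hs => by
      have := (hasDerivAt_fresnel (phaseRoot r s)).scomp s (hasDerivAt_phaseRoot r (hpos s hs))
      refine (this.sub_const c).congr_deriv ?_
      rw [Complex.real_smul, mul_comm])
    (by
      refine ContinuousOn.div (by fun_prop) (by fun_prop) fun s hs => ?_
      have := hpos s hs
      positivity)
    (by
      have h1 : ContinuousOn (phaseRoot r) (Set.Icc α β) := fun s hs =>
        (hasDerivAt_phaseRoot r (hpos s hs)).continuousAt.continuousWithinAt
      have h2 : ContinuousOn (fun s => (s + r) / (4 * (s * √s))) (Set.Icc α β) := by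
        refine ContinuousOn.div (by fun_prop) (by fun_prop) fun s hs => ?_
        have := hpos s hs
        positivity
      exact (continuous_exp_I_mul_sq.comp_continuousOn h1).mul
        (Complex.continuous_ofReal.comp_continuousOn h2))
    (fun s hs => by
      have := hpos s hs
      refine div_nonpos_of_nonpos_of_nonneg ?_ (by positivity)
      have h1 : 0 ≤ Real.exp (-ε * (s - t)) * ε * (s + r) := by positivity
      have h2 := Real.exp_pos (-ε * (s - t))
      nlinarith)
    (fun s hs => by have := hpos s hs; positivity) hK
  rw [intervalIntegral.integral_congr (g := fun s =>
    Complex.exp (((r / 2 - t / 4 : ℝ) : ℂ) * Complex.I) *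
      (((4 * Real.exp (-ε * (s - t)) / (s + r) : ℝ) : ℂ) *
        (Complex.exp (Complex.I * (phaseRoot r s : ℂ) ^ 2) *
          (((s + r) / (4 * (s * √s)) : ℝ) : ℂ))))
    (fun s hs => gIntegrand_eq ε t hr (hpos s (Set.uIcc_of_le hαβ ▸ hs))),
    intervalIntegral.integral_const_mul, norm_mul, Complex.norm_exp_ofReal_mul_I, one_mul]
  refine h.trans_eq ?_
  ring

theorem norm_gIntegrand (ε r t : ℝ) {s : ℝ} (hs : 0 < s) :
    ‖gIntegrand ε r t s‖ = Real.exp (-ε * (s - t)) * s ^ (-(3 : ℝ) / 2) := by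
  have h : Complex.I * (((s : ℂ) - (t : ℂ)) * (1 / 4 + (ε : ℂ) * Complex.I)
      + (r : ℂ) ^ 2 / (4 * (s : ℂ))) = ((-ε * (s - t) : ℝ) : ℂ) +
      (((s - t) / 4 + r ^ 2 / (4 * s) : ℝ) : ℂ) * Complex.I := by
    push_cast
    linear_combination ((s : ℂ) - t) * ε * Complex.I_sq
  rw [gIntegrand, h, Complex.exp_add, norm_mul, norm_mul, Complex.norm_exp_ofReal_mul_I, mul_one,
    ← Complex.ofReal_exp, Complex.norm_of_nonneg (Real.exp_pos _).le,
    Complex.norm_of_nonneg (Real.rpow_nonneg hs.le _)]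

theorem norm_setIntegral_Ioi_le_of_eventually {f : ℝ → ℂ} {t M : ℝ} (hM : 0 ≤ M)
    (h : ∀ᶠ T in Filter.atTop, ‖∫ s in t..T, f s‖ ≤ M) : ‖∫ s in Set.Ioi t, f s‖ ≤ M := by
  by_cases hf : IntegrableOn f (Set.Ioi t)
  · exact le_of_tendsto (intervalIntegral_tendsto_integral_Ioi t hf Filter.tendsto_id).norm h
  · rwa [integral_undef hf, norm_zero]

theorem norm_integral_gIntegrand_le_div_add {ε r t : ℝ} (hε : 0 ≤ ε) (hr : 0 ≤ r) (ht : 0 < t) :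
    ‖∫ s in Set.Ioi t, gIntegrand ε r t s‖ ≤ 16 / (t + r) := by
  refine norm_setIntegral_Ioi_le_of_eventually (by positivity) ?_
  filter_upwards [Filter.eventually_ge_atTop t] with T hT
  refine (norm_intervalIntegral_gIntegrand_le hε hr ht hT 0 (K := 2) fun s _ => ?_).trans_eq ?_
  · rw [sub_zero]; exact norm_fresnel_le _
  · rw [sub_self, mul_zero, Real.exp_zero]; norm_num

theorem norm_integral_gIntegrand_mul_sqrt_le {ε t : ℝ} (r : ℝ) (hε : 0 ≤ ε) (ht : 0 < t) :
    ‖∫ s in Set.Ioi t, gIntegrand ε r t s‖ * √t ≤ 2 := by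
  have h : ‖∫ s in Set.Ioi t, gIntegrand ε r t s‖ ≤ ∫ s in Set.Ioi t, s ^ (-(3 : ℝ) / 2) := by
    refine norm_integral_le_of_norm_le (integrableOn_Ioi_rpow_of_lt (by norm_num) ht) ?_
    filter_upwards [ae_restrict_mem measurableSet_Ioi] with s hs
    have hs' : t < s := hs
    rw [norm_gIntegrand ε r t (ht.trans hs')]
    refine mul_le_of_le_one_left (Real.rpow_nonneg (ht.trans hs').le _) ?_
    rw [Real.exp_le_one_iff]
    nlinarith
  rw [integral_Ioi_rpow_of_lt (by norm_num) ht, show -(3 : ℝ) / 2 + 1 = -(1 / 2) by norm_num,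
    Real.rpow_neg ht.le, ← Real.sqrt_eq_rpow] at h
  have h0 := Real.sqrt_pos.2 ht
  calc _ ≤ _ := mul_le_mul_of_nonneg_right h h0.le
    _ = 2 := by field_simp

theorem norm_integral_gIntegrand_mul_le {ε t : ℝ} (r : ℝ) (hε : 0 < ε) (ht : 0 < t) :
    ε * ‖∫ s in Set.Ioi t, gIntegrand ε r t s‖ ≤ (t * √t)⁻¹ := by
  have hε' : -ε < 0 := neg_lt_zero.2 hε
  have h : ‖∫ s in Set.Ioi t, gIntegrand ε r t s‖ ≤
      ∫ s in Set.Ioi t, (t * √t)⁻¹ * Real.exp (ε * t) * Real.exp (-ε * s) := by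
    refine norm_integral_le_of_norm_le ((integrableOn_exp_mul_Ioi hε' t).const_mul _) ?_
    filter_upwards [ae_restrict_mem measurableSet_Ioi] with s hs
    have hs' : t < s := hs
    have hs0 := ht.trans hs'
    have hsq := Real.sqrt_pos.2 ht
    have hsq' := Real.sqrt_le_sqrt hs'.le
    rw [norm_gIntegrand ε r t hs0, rpow_neg_three_halves hs0, mul_assoc, ← Real.exp_add, mul_comm,
      show ε * t + -ε * s = -ε * (s - t) by ring]
    gcongr
  rw [integral_const_mul, integral_exp_mul_Ioi hε'] at h
  calc _ ≤ _ := mul_le_mul_of_nonneg_left h hε.le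
    _ = (t * √t)⁻¹ * (Real.exp (ε * t) * Real.exp (-ε * t)) := by field_simp
    _ = _ := by rw [← Real.exp_add]; simp

theorem norm_integral_gIntegrand_le_of_le {ε r t : ℝ} (hε : 0 ≤ ε) (ht : 0 < t)
    (hr : 8 * t ≤ r) :
    ‖∫ s in Set.Ioi t, gIntegrand ε r t s‖ ≤
      11 / (r * √r) + 16 * Real.exp (-ε * r / 8) / r := by
  have hr0 : 0 < r := by linarith
  have hsr := Real.sqrt_pos.2 hr0
  have htr : t ≤ r / 4 := by linarith
  have hcont : ContinuousOn (gIntegrand ε r t) (Set.Ioi 0) := by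
    intro s hs
    have hs0 : (s : ℂ) ≠ 0 := by exact_mod_cast (ne_of_gt hs)
    refine ContinuousAt.continuousWithinAt ?_
    unfold gIntegrand
    refine ContinuousAt.mul (ContinuousAt.cexp ?_) (Complex.continuous_ofReal.continuousAt.comp
      (Real.continuousAt_rpow_const _ _ (Or.inl (ne_of_gt hs))))
    refine ContinuousAt.mul continuousAt_const (ContinuousAt.add (by fun_prop)
      (ContinuousAt.div (by fun_prop) (by fun_prop) (by simpa using hs0)))
  have hii : ∀ a b : ℝ, 0 < a → 0 < b → IntervalIntegrable (gIntegrand ε r t) volume a b :=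
    fun a b ha hb => (hcont.mono fun s hs =>
      (lt_min ha hb).trans_le hs.1).intervalIntegrable
  have hroot : phaseRoot r (r / 4) = -(3 / 4 * √r) := by
    have h4 : √(r / 4) = √r / 2 := by
      rw [Real.sqrt_div hr0.le, show (4 : ℝ) = 2 ^ 2 by norm_num, Real.sqrt_sq (by norm_num)]
    have := Real.sq_sqrt hr0.le
    rw [phaseRoot, h4]
    field_simp
    linarith
  refine norm_setIntegral_Ioi_le_of_eventually (by positivity) ?_
  filter_upwards [Filter.eventually_ge_atTop (r / 4)] with T hT
  have h1 : ‖∫ s in t..r / 4, gIntegrand ε r t s‖ ≤ 11 / (r * √r) := by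
    refine (norm_intervalIntegral_gIntegrand_le hε hr0.le ht htr (fresnel (phaseRoot r (r / 4)))
      (K := (3 / 4 * √r)⁻¹) fun s hs => ?_).trans ?_
    · have hs0 : 0 < s := ht.trans_le hs.1
      have hmono : phaseRoot r s ≤ phaseRoot r (r / 4) := by
        have h0 := Real.sqrt_pos.2 hs0
        have hle := Real.sqrt_le_sqrt hs.2
        unfold phaseRoot
        gcongr
      have := norm_fresnel_sub_le_of_neg (by rw [hroot]; linarith [hsr]) hmono
      rwa [hroot, neg_neg, ← hroot] at this
    · rw [sub_self, mul_zero, Real.exp_zero, mul_one, div_le_div_iff₀ (by positivity)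
        (by positivity)]
      have : 8 * (3 / 4 * √r)⁻¹ * (r * √r) = 32 / 3 * r := by field_simp; norm_num
      rw [this]
      linarith
  have h2 : ‖∫ s in r / 4..T, gIntegrand ε r t s‖ ≤ 16 * Real.exp (-ε * r / 8) / r := by
    refine (norm_intervalIntegral_gIntegrand_le hε hr0.le (by positivity) hT 0
      (K := 2) fun s _ => ?_).trans ?_
    · rw [sub_zero]; exact norm_fresnel_le _
    · rw [show (8 : ℝ) * 2 = 16 by norm_num]
      gcongr 16 * Real.exp ?_ / ?_
      · nlinarith
      · linarith
  rw [← intervalIntegral.integral_add_adjacent_intervals (hii t (r / 4) ht (by positivity))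
    (hii (r / 4) T (by positivity) (by linarith))]
  exact (norm_add_le _ _).trans (add_le_add h1 h2)

theorem norm_Gker_le (ε r t : ℝ) :
    ‖Gker ε r t‖ ≤ ‖∫ s in Set.Ioi t, gIntegrand ε r t s‖ := by
  rw [Gker, norm_mul]
  refine mul_le_of_le_one_left (norm_nonneg _) ?_
  have hpi : (1 : ℝ) ≤ Real.pi ^ ((3 : ℝ) / 2) :=
    Real.one_le_rpow (by linarith [Real.pi_gt_three]) (by norm_num)
  have h : -((Real.pi / 4 : ℝ) : ℂ) * Complex.I = ((-(Real.pi / 4) : ℝ) : ℂ) * Complex.I := by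
    push_cast; ring
  rw [norm_div, h, Complex.norm_exp_ofReal_mul_I, Complex.norm_real, Real.norm_eq_abs,
    abs_of_pos (by positivity), div_le_one (by positivity)]
  linarith

theorem sqrt_mul_norm_Gker_le {ε r t : ℝ} (hε : ε ∈ Set.Ioc (0 : ℝ) 1) (hr : 0 ≤ r)
    (ht : 0 < t) : √ε * ‖Gker ε r t‖ ≤ 50 / (√t + r) := by
  have h1 := norm_integral_gIntegrand_le_div_add hε.1.le hr ht
  have h2 := norm_integral_gIntegrand_mul_sqrt_le r hε.1.le ht
  have h3 := norm_Gker_le ε r t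
  have h4 : √ε ≤ 1 := Real.sqrt_le_one.2 hε.2
  have h0 := Real.sqrt_pos.2 ht
  have hN := norm_nonneg (∫ s in Set.Ioi t, gIntegrand ε r t s)
  rw [le_div_iff₀ (by positivity)] at h1
  rw [le_div_iff₀ (by positivity)]
  calc √ε * ‖Gker ε r t‖ * (√t + r)
      ≤ 1 * ‖∫ s in Set.Ioi t, gIntegrand ε r t s‖ * (√t + r) := by gcongr
    _ ≤ 50 := by nlinarith

theorem sqrt_mul_norm_Gker_le_of_one_le {ε r t : ℝ} (hε : ε ∈ Set.Ioc (0 : ℝ) 1) (hr : 0 ≤ r)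
    (ht1 : 1 ≤ t) : √ε * ‖Gker ε r t‖ ≤ 50 * t ^ (-(1 / 4 : ℝ)) / (t + r) := by
  have ht : 0 < t := one_pos.trans_le ht1
  refine (mul_le_mul_of_nonneg_left (norm_Gker_le ε r t) (Real.sqrt_nonneg ε)).trans ?_
  have hN := norm_nonneg (∫ s in Set.Ioi t, gIntegrand ε r t s)
  set q : ℝ := t ^ (-(1 / 4 : ℝ)) with hq
  have hq0 : 0 < q := Real.rpow_pos_of_pos ht _
  have hq2 : q ^ 2 = (√t)⁻¹ := by
    rw [hq, ← Real.rpow_natCast, ← Real.rpow_mul ht.le, Real.sqrt_eq_rpow, ← Real.rpow_neg ht.le]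
    norm_num
  have hq1 : q ≤ 1 := Real.rpow_le_one_of_one_le_of_nonpos ht1 (by norm_num)
  have hst := Real.sqrt_pos.2 ht
  have hε0 := hε.1
  have hsε := Real.sq_sqrt hε0.le
  have h4 : √ε ≤ 1 := Real.sqrt_le_one.2 hε.2
  have h40 := Real.sqrt_nonneg ε
  rcases le_total (8 * t) r with h8 | h8
  · have hr0 : 0 < r := by linarith
    have hsr := Real.sqrt_pos.2 hr0
    have hsr2 := Real.sq_sqrt hr0.le
    have hexp : √ε * √r * Real.exp (-ε * r / 8) ≤ 2 := by
      have h5 := Real.add_one_le_exp (ε * r / 8)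
      have h6 : √ε * √r ≤ 2 * Real.exp (ε * r / 8) := by
        have : (√ε * √r) ^ 2 = ε * r := by rw [mul_pow, hsε, hsr2]
        nlinarith [sq_nonneg (√ε * √r / 2 - 1)]
      calc _ ≤ 2 * Real.exp (ε * r / 8) * Real.exp (-ε * r / 8) := by gcongr
        _ = 2 := by rw [mul_assoc, ← Real.exp_add]; ring_nf; simp
    have h1 := norm_integral_gIntegrand_le_of_le hε0.le ht h8
    have hsq : (√r)⁻¹ ≤ q := by
      calc (√r)⁻¹ ≤ (√t)⁻¹ := by gcongr; linarith
        _ = q ^ 2 := hq2.symm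
        _ ≤ q := by nlinarith
    calc √ε * ‖∫ s in Set.Ioi t, gIntegrand ε r t s‖
        ≤ √ε * (11 / (r * √r) + 16 * Real.exp (-ε * r / 8) / r) := by gcongr
      _ = (11 * √ε + 16 * (√ε * √r * Real.exp (-ε * r / 8))) * (√r)⁻¹ / r := by
        field_simp
      _ ≤ (11 * 1 + 16 * 2) * q / r := by gcongr
      _ ≤ 50 * q / (t + r) := by
        rw [div_le_div_iff₀ hr0 (by positivity)]
        nlinarith [mul_le_mul_of_nonneg_left h8 hq0.le]
  · have h1 := norm_integral_gIntegrand_le_div_add hε0.le hr ht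
    have h2 := norm_integral_gIntegrand_mul_le r hε0 ht
    set N := ‖∫ s in Set.Ioi t, gIntegrand ε r t s‖
    have h5 : √ε * N ≤ 4 * q / t := by
      refine (pow_le_pow_iff_left₀ (by positivity) (by positivity) two_ne_zero).1 ?_
      calc (√ε * N) ^ 2 = (ε * N) * N := by rw [mul_pow, hsε]; ring
        _ ≤ (t * √t)⁻¹ * (16 / t) := by
          gcongr
          refine h1.trans ?_
          gcongr
          linarith
        _ = (4 * q / t) ^ 2 := by rw [div_pow, mul_pow, hq2]; field_simp; norm_num
    refine h5.trans ?_
    rw [div_le_div_iff₀ ht (by positivity)]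
    nlinarith [mul_le_mul_of_nonneg_left h8 hq0.le, mul_pos hq0 ht]

open scoped ENNReal in
theorem lintegral_rpow_lintegral_sub_mul_le {E : Type*} [AddCommGroup E] [MeasurableSpace E]
    [MeasurableAdd₂ E] [MeasurableSub₂ E] (μ : Measure E) [SFinite μ]
    [μ.IsAddRightInvariant] {k h : E → ℝ≥0∞} (hk : Measurable k) (hh : AEMeasurable h μ)
    {p : ℝ} (hp : 1 ≤ p) :
    ∫⁻ x, (∫⁻ y, k (x - y) * h y ∂μ) ^ p ∂μ ≤ (∫⁻ x, k x ^ p ∂μ) * (∫⁻ y, h y ∂μ) ^ p := by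
  have hp0 : 0 < p := one_pos.trans_le hp
  have hp1 : 0 ≤ 1 - 1 / p := sub_nonneg.2 (by rw [div_le_one hp0]; exact hp)
  have hsub : ∀ x, Measurable fun y => k (x - y) := fun x =>
    hk.comp (measurable_const.sub measurable_id)
  have hpt : ∀ x, (∫⁻ y, k (x - y) * h y ∂μ) ^ p ≤
      (∫⁻ y, k (x - y) ^ p * h y ∂μ) * (∫⁻ y, h y ∂μ) ^ (p - 1) := fun x => by
    have hfac : ∀ y, k (x - y) * h y = (k (x - y) ^ p * h y) ^ (1 / p) * h y ^ (1 - 1 / p) := by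
      intro y
      rw [ENNReal.mul_rpow_of_nonneg _ _ (by positivity), ← ENNReal.rpow_mul,
        mul_one_div_cancel hp0.ne', ENNReal.rpow_one, mul_assoc,
        ← ENNReal.rpow_add_of_nonneg _ _ (by positivity) hp1, add_sub_cancel, ENNReal.rpow_one]
    simp_rw [hfac]
    calc _ ≤ ((∫⁻ y, k (x - y) ^ p * h y ∂μ) ^ (1 / p) * (∫⁻ y, h y ∂μ) ^ (1 - 1 / p)) ^ p := by
          gcongr
          exact ENNReal.lintegral_mul_norm_pow_le
            (((hsub x).pow_const p).aemeasurable.mul hh) hh (by positivity) hp1 (by ring)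
      _ = _ := by
          rw [ENNReal.mul_rpow_of_nonneg _ _ hp0.le, ← ENNReal.rpow_mul, ← ENNReal.rpow_mul,
            one_div_mul_cancel hp0.ne', ENNReal.rpow_one, sub_mul, one_mul,
            one_div_mul_cancel hp0.ne']
  have hswap : ∫⁻ x, ∫⁻ y, k (x - y) ^ p * h y ∂μ ∂μ =
      (∫⁻ x, k x ^ p ∂μ) * ∫⁻ y, h y ∂μ := by
    rw [lintegral_lintegral_swap]
    · calc _ = ∫⁻ y, (∫⁻ x, k x ^ p ∂μ) * h y ∂μ := by
            refine lintegral_congr fun y => ?_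
            have hm : Measurable fun x => k (x - y) ^ p :=
              (hk.comp (measurable_id.sub measurable_const)).pow_const p
            rw [lintegral_mul_const _ hm,
              lintegral_sub_right_eq_self (fun x => k x ^ p) y]
        _ = _ := lintegral_const_mul'' _ hh
    · exact ((hk.comp (measurable_fst.sub measurable_snd)).pow_const p).aemeasurable.mul
        hh.comp_snd
  calc _ ≤ ∫⁻ x, (∫⁻ y, k (x - y) ^ p * h y ∂μ) * (∫⁻ y, h y ∂μ) ^ (p - 1) ∂μ :=
        lintegral_mono hpt
    _ = (∫⁻ x, k x ^ p ∂μ) * ((∫⁻ y, h y ∂μ) * (∫⁻ y, h y ∂μ) ^ (p - 1)) := by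
        rw [lintegral_mul_const'', hswap, mul_assoc]
        exact AEMeasurable.lintegral_prod_right'
          (f := fun z : E × E => k (z.1 - z.2) ^ p * h z.2)
          (((hk.comp (measurable_fst.sub measurable_snd)).pow_const p).aemeasurable.mul
            hh.comp_snd)
    _ = _ := by
        congr 1
        nth_rw 1 [← ENNReal.rpow_one (∫⁻ y, h y ∂μ)]
        rw [← ENNReal.rpow_add_of_nonneg _ _ zero_le_one (by linarith), add_sub_cancel]

theorem lintegral_div_add_norm_rpow {p A R : ℝ} (hp : 3 < p) (hA : 0 ≤ A) (hR : 0 < R) :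
    ∫⁻ x : EuclideanSpace ℝ (Fin 3), ENNReal.ofReal (A / (R + ‖x‖)) ^ p =
      ENNReal.ofReal (A ^ p * R ^ (3 - p) *
        ∫ x : EuclideanSpace ℝ (Fin 3), (1 + ‖x‖) ^ (-p)) := by
  have hint : Integrable fun x : EuclideanSpace ℝ (Fin 3) => (1 + ‖x‖) ^ (-p) :=
    integrable_one_add_norm (by simpa using hp)
  have hscale : ∀ x : EuclideanSpace ℝ (Fin 3), (A / (R + ‖x‖)) ^ p =
      A ^ p * R ^ (-p) * (1 + ‖R⁻¹ • x‖) ^ (-p) := fun x => by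
    have h1 : R + ‖x‖ = R * (1 + ‖R⁻¹ • x‖) := by
      rw [norm_smul, norm_inv, Real.norm_of_nonneg hR.le]
      field_simp
    rw [h1, Real.div_rpow hA (by positivity), Real.mul_rpow hR.le (by positivity),
      Real.rpow_neg hR.le, Real.rpow_neg (by positivity)]
    field_simp
  have hp0 : 0 ≤ p := by linarith
  calc _ = ∫⁻ x : EuclideanSpace ℝ (Fin 3),
        ENNReal.ofReal (A ^ p * R ^ (-p) * (1 + ‖R⁻¹ • x‖) ^ (-p)) := by
        refine lintegral_congr fun x => ?_
        rw [ENNReal.ofReal_rpow_of_nonneg (by positivity) hp0, hscale]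
    _ = ENNReal.ofReal (∫ x : EuclideanSpace ℝ (Fin 3),
        A ^ p * R ^ (-p) * (1 + ‖R⁻¹ • x‖) ^ (-p)) := by
        refine (ofReal_integral_eq_lintegral_ofReal ?_ ?_).symm
        · exact ((integrable_comp_smul_iff volume _ (inv_ne_zero hR.ne')).2 hint).const_mul _
        · exact Filter.Eventually.of_forall fun x => by positivity
    _ = _ := by
        rw [integral_const_mul, Measure.integral_comp_inv_smul_of_nonneg volume
          (fun x : EuclideanSpace ℝ (Fin 3) => (1 + ‖x‖) ^ (-p)) hR.le, finrank_euclideanSpace_fin,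
          smul_eq_mul, sub_eq_neg_add, Real.rpow_add hR]
        norm_cast
        rw [← mul_assoc, ← mul_assoc]

theorem eLpNorm_le_of_enorm_le_lintegral_div_add_norm {p : ENNReal} (hp : 3 < p) :
    ∃ C : ℝ, 0 < C ∧ ∀ A R : ℝ, 0 ≤ A → 0 < R →
      ∀ u g : EuclideanSpace ℝ (Fin 3) → ℂ, Integrable g volume →
        (∀ x, ‖u x‖ₑ ≤ ∫⁻ y, ENNReal.ofReal (A / (R + ‖x - y‖)) * ‖g y‖ₑ) →
        eLpNorm u p volume ≤ ENNReal.ofReal (C * (A * R ^ (-(2 * mExp p))) * ∫ y, ‖g y‖) := by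
  rcases eq_or_ne p ⊤ with rfl | hpt
  · refine ⟨1, one_pos, fun A R hA hR u g hg hu => ?_⟩
    rw [eLpNorm_exponent_top]
    refine eLpNormEssSup_le_of_ae_enorm_bound (Filter.Eventually.of_forall fun x => ?_)
    calc ‖u x‖ₑ ≤ _ := hu x
      _ ≤ ∫⁻ y, ENNReal.ofReal (A / R) * ‖g y‖ₑ := by
        gcongr with y
        linarith [norm_nonneg (x - y)]
      _ = _ := by
        rw [lintegral_const_mul'' _ hg.aestronglyMeasurable.enorm,
          ← ofReal_integral_norm_eq_lintegral_enorm hg, ← ENNReal.ofReal_mul (by positivity)]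
        congr 2
        simp [mExp, Real.rpow_neg_one, div_eq_mul_inv]
  · have hq : 3 < p.toReal := by
      simpa using (ENNReal.toReal_lt_toReal (by simp) hpt).2 hp
    set q := p.toReal with hqdef
    have hq0 : 0 < q := by linarith
    set c := ∫ x : EuclideanSpace ℝ (Fin 3), (1 + ‖x‖) ^ (-q)
    have hc : 0 ≤ c := integral_nonneg fun x => by positivity
    refine ⟨c ^ (1 / q) + 1, by positivity, fun A R hA hR u g hg hu => ?_⟩
    have hI : 0 ≤ ∫ y, ‖g y‖ := integral_nonneg fun y => norm_nonneg _
    have hyoung := lintegral_rpow_lintegral_sub_mul_le (volume : Measure (EuclideanSpace ℝ (Fin 3)))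
      (k := fun x => ENNReal.ofReal (A / (R + ‖x‖))) (h := fun y => ‖g y‖ₑ)
      (by fun_prop) hg.aestronglyMeasurable.enorm (p := q) (by linarith)
    rw [lintegral_div_add_norm_rpow hq hA hR, ← ofReal_integral_norm_eq_lintegral_enorm hg,
      ENNReal.ofReal_rpow_of_nonneg hI hq0.le, ← ENNReal.ofReal_mul (by positivity)] at hyoung
    rw [eLpNorm_eq_lintegral_rpow_enorm_toReal (by rintro rfl; simp at hp) hpt, ← hqdef]
    calc (∫⁻ x, ‖u x‖ₑ ^ q) ^ (1 / q)
        ≤ ENNReal.ofReal (A ^ q * R ^ (3 - q) * c * (∫ y, ‖g y‖) ^ q) ^ (1 / q) :=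
          ENNReal.rpow_le_rpow ((lintegral_mono fun x =>
            ENNReal.rpow_le_rpow (hu x) hq0.le).trans hyoung) (by positivity)
      _ = ENNReal.ofReal (c ^ (1 / q) * (A * R ^ (-(2 * mExp p))) * ∫ y, ‖g y‖) := by
          rw [ENNReal.ofReal_rpow_of_nonneg (by positivity) (by positivity)]
          congr 1
          rw [Real.mul_rpow (by positivity) (by positivity), Real.mul_rpow (by positivity) hc,
            Real.mul_rpow (by positivity) (by positivity), ← Real.rpow_mul hA, ← Real.rpow_mul hI,
            ← Real.rpow_mul hR.le, mul_one_div_cancel hq0.ne', Real.rpow_one, Real.rpow_one,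
            show (3 - q) * (1 / q) = -(2 * mExp p) by rw [mExp, ← hqdef]; field_simp; ring]
          ring
      _ ≤ _ := by
          gcongr
          linarith

theorem mExp_pos {p : ENNReal} (hp : 3 < p) : 0 < mExp p := by
  rcases eq_or_ne p ⊤ with rfl | hpt
  · simp [mExp]
  · have hq : 3 < p.toReal := by
      simpa using (ENNReal.toReal_lt_toReal (by simp) hpt).2 hp
    rw [mExp, sub_pos, div_lt_div_iff₀ (by linarith) (by norm_num)]
    linarith

theorem mExp_le_half (p : ENNReal) : mExp p ≤ 1 / 2 :=
  sub_le_self _ (by positivity)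

theorem rpow_mul_one_add_rpow_ge_of_le_one {m t : ℝ} (hm : 0 < m) (hm' : m ≤ 1 / 2) (ht : 0 < t)
    (ht1 : t ≤ 1) : t ^ (-m) ≤ 2 * (t ^ (-m) * (1 + t) ^ (-m - min m (1 / 4))) := by
  have h1 : (2 : ℝ)⁻¹ ≤ (1 + t) ^ (-m - min m (1 / 4)) := by
    calc (2 : ℝ)⁻¹ = 2 ^ (-1 : ℝ) := (Real.rpow_neg_one 2).symm
      _ ≤ 2 ^ (-m - min m (1 / 4)) :=
        Real.rpow_le_rpow_of_exponent_le one_le_two (by linarith [min_le_right m (1 / 4)])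
      _ ≤ (1 + t) ^ (-m - min m (1 / 4)) :=
        Real.rpow_le_rpow_of_nonpos (by linarith) (by linarith)
          (by linarith [lt_min hm (show (0 : ℝ) < 1 / 4 by norm_num)])
  nlinarith [Real.rpow_pos_of_pos ht (-m)]

theorem rpow_mul_one_add_rpow_ge_of_one_le {m t : ℝ} (hm : 0 < m) (hm' : m ≤ 1 / 2)
    (ht1 : 1 ≤ t) :
    t ^ (-(1 / 4 : ℝ)) * t ^ (-(2 * m)) ≤
      2 * (t ^ (-m) * (1 + t) ^ (-m - min m (1 / 4))) := by
  have ht : 0 < t := one_pos.trans_le ht1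
  have hmin := lt_min hm (show (0 : ℝ) < 1 / 4 by norm_num)
  have hmin' := min_le_right m (1 / 4)
  have h1 : (2 : ℝ)⁻¹ * t ^ (-m - 1 / 4) ≤ (1 + t) ^ (-m - min m (1 / 4)) := by
    calc (2 : ℝ)⁻¹ * t ^ (-m - 1 / 4) = 2 ^ (-1 : ℝ) * t ^ (-m - 1 / 4) := by
          rw [Real.rpow_neg_one]
      _ ≤ 2 ^ (-m - min m (1 / 4)) * t ^ (-m - min m (1 / 4)) := by
        gcongr
        · norm_num
        · linarith
      _ = (2 * t) ^ (-m - min m (1 / 4)) := (Real.mul_rpow two_pos.le ht.le).symm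
      _ ≤ (1 + t) ^ (-m - min m (1 / 4)) :=
        Real.rpow_le_rpow_of_nonpos (by linarith) (by linarith) (by linarith)
  have h2 : t ^ (-(1 / 4 : ℝ)) * t ^ (-(2 * m)) = t ^ (-m) * t ^ (-m - 1 / 4) := by
    rw [← Real.rpow_add ht, ← Real.rpow_add ht]
    ring_nf
  rw [h2]
  nlinarith [mul_le_mul_of_nonneg_left h1 (Real.rpow_pos_of_pos ht (-m)).le]

theorem enorm_mul_integral_le_lintegral_div_add_norm {c : ℝ} (hc : 0 ≤ c) {κ : ℝ → ℂ} {A R : ℝ}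
    (hκ : ∀ r, 0 ≤ r → c * ‖κ r‖ ≤ A / (R + r))
    (g : EuclideanSpace ℝ (Fin 3) → ℂ) (x : EuclideanSpace ℝ (Fin 3)) :
    ‖(c : ℂ) * ∫ y, κ ‖x - y‖ * g y‖ₑ ≤
      ∫⁻ y, ENNReal.ofReal (A / (R + ‖x - y‖)) * ‖g y‖ₑ := by
  rw [← integral_const_mul]
  refine (enorm_integral_le_lintegral_enorm _).trans (lintegral_mono fun y => ?_)
  rw [← mul_assoc, enorm_mul]
  gcongr
  rw [← ofReal_norm, norm_mul, Complex.norm_real, Real.norm_of_nonneg hc]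
  exact ENNReal.ofReal_le_ofReal (hκ _ (norm_nonneg _))

/-- Free-case decay estimate (Lemma 2.10 of the paper with V = 0): for every
`3 < p ≤ ∞` there is `C_p > 0` such that for all `ε ∈ (0,1]`, `t > 0` and
`g ∈ L¹(ℝ³)`,
`‖ √ε · (G_ε(|·|,t) * g) ‖_{L^p} ≤ C_p t^{-m}(1+t)^{-m-min(m,1/4)} ‖g‖_{L¹}`,
where `m = 1/2 − 3/(2p)`. -/
theorem stmt5 (p : ENNReal) (hp : 3 < p) :
    ∃ C : ℝ, 0 < C ∧
      ∀ ε ∈ Set.Ioc (0 : ℝ) 1, ∀ t : ℝ, 0 < t →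
        ∀ g : EuclideanSpace ℝ (Fin 3) → ℂ, Integrable g volume →
          eLpNorm (fun x => (Real.sqrt ε : ℂ) * ∫ y, Gker ε ‖x - y‖ t * g y) p volume ≤
            ENNReal.ofReal
              (C * t ^ (-(mExp p)) * (1 + t) ^ (-(mExp p) - min (mExp p) (1 / 4)) *
                ∫ y, ‖g y‖) := by
  obtain ⟨C, hC, hyoung⟩ := eLpNorm_le_of_enorm_le_lintegral_div_add_norm hp
  have hm := mExp_pos hp
  have hm' := mExp_le_half p
  refine ⟨100 * C, by positivity, fun ε hε t ht g hg => ?_⟩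
  have hI : 0 ≤ ∫ y, ‖g y‖ := integral_nonneg fun y => norm_nonneg _
  rcases le_total t 1 with ht1 | ht1
  · refine (hyoung 50 (√t) (by norm_num) (Real.sqrt_pos.2 ht) _ g hg
      (enorm_mul_integral_le_lintegral_div_add_norm (Real.sqrt_nonneg ε)
        (κ := fun r => Gker ε r t)
        (fun r hr => sqrt_mul_norm_Gker_le hε hr ht) g)).trans ?_
    refine ENNReal.ofReal_le_ofReal (mul_le_mul_of_nonneg_right ?_ hI)
    rw [Real.sqrt_eq_rpow, ← Real.rpow_mul ht.le,
      show 1 / 2 * -(2 * mExp p) = -mExp p by ring]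
    nlinarith [mul_le_mul_of_nonneg_left (rpow_mul_one_add_rpow_ge_of_le_one hm hm' ht ht1) hC.le]
  · refine (hyoung (50 * t ^ (-(1 / 4 : ℝ))) t (by positivity) ht _ g hg
      (enorm_mul_integral_le_lintegral_div_add_norm (Real.sqrt_nonneg ε)
        (κ := fun r => Gker ε r t)
        (fun r hr => sqrt_mul_norm_Gker_le_of_one_le hε hr ht1) g)).trans ?_
    refine ENNReal.ofReal_le_ofReal (mul_le_mul_of_nonneg_right ?_ hI)
    nlinarith [mul_le_mul_of_nonneg_left (rpow_mul_one_add_rpow_ge_of_one_le hm hm' ht1) hC.le]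
end

section
/- In the normal-form setting below, suppose in addition that γ ≥ 0 is a real number with γ ≤ γ_{ab}^0 for all a,b ∈ {1,…,K}. Set f_j(t) = |μ_j(t)|² and f = f_1 + … + f_K. Then at the point t: (i) f_0'(t) ≥ 2γ f(t)² f_0(t) + 2 Re( conj(μ_0(t)) g_0(t) ); and (ii) f'(t) ≤ −4γ f_0(t) f(t)² + Σ_{l=1}^{K} 2 Re( conj(μ_l(t)) g_l(t) ). -/
open Finset

/-- If `z' = u z + w z + g` with `u` purely imaginary, then
`(|z|²)' = 2 Re(w) |z|² + 2 Re(conj(z) g)`. -/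
theorem hasDerivAt_norm_sq_of_re_eq_zero {z : ℝ → ℂ} {t : ℝ} {u w g : ℂ} (hu : u.re = 0)
    (hz : HasDerivAt z (u * z t + w * z t + g) t) :
    HasDerivAt (fun s => ‖z s‖ ^ 2)
      (2 * (w.re * ‖z t‖ ^ 2) + 2 * ((starRingEnd ℂ) (z t) * g).re) t := by
  convert hz.norm_sq using 1
  rw [Complex.inner, ← Complex.normSq_eq_norm_sq, Complex.normSq_apply]
  simp only [Complex.mul_re, Complex.add_re, Complex.add_im, Complex.mul_im, Complex.conj_re,
    Complex.conj_im, hu]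
  ring

/-- A weighted quadratic form with nonnegative coefficients dominates the square of the partial sum
over the indices at which the coefficients are at least `γ₀`. -/
theorem mul_sq_sum_succ_le {K : ℕ} {A : Fin (K + 1) → Fin (K + 1) → ℝ} {F : Fin (K + 1) → ℝ}
    {γ₀ : ℝ} (hF : ∀ a, 0 ≤ F a) (hA : ∀ a b, 0 ≤ A a b)
    (hA' : ∀ a b : Fin K, γ₀ ≤ A a.succ b.succ) :
    γ₀ * (∑ l : Fin K, F l.succ) ^ 2 ≤ ∑ a, ∑ b, A a b * F a * F b := by
  have hnonneg : ∀ a b, 0 ≤ A a b * F a * F b := fun a b =>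
    mul_nonneg (mul_nonneg (hA a b) (hF a)) (hF b)
  calc γ₀ * (∑ l : Fin K, F l.succ) ^ 2
      = ∑ a : Fin K, ∑ b : Fin K, γ₀ * F a.succ * F b.succ := by
        rw [sq, Finset.sum_mul_sum]
        simp only [Finset.mul_sum, mul_assoc]
    _ ≤ ∑ a : Fin K, ∑ b : Fin K, A a.succ b.succ * F a.succ * F b.succ :=
        Finset.sum_le_sum fun a _ => Finset.sum_le_sum fun b _ =>
          mul_le_mul_of_nonneg_right (mul_le_mul_of_nonneg_right (hA' a b) (hF _)) (hF _)
    _ ≤ ∑ a : Fin K, ∑ b, A a.succ b * F a.succ * F b :=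
        Finset.sum_le_sum fun a _ => by
          rw [Fin.sum_univ_succ]
          exact le_add_of_nonneg_left (hnonneg _ _)
    _ ≤ ∑ a, ∑ b, A a b * F a * F b := by
        rw [Fin.sum_univ_succ (fun a => ∑ b, A a b * F a * F b)]
        exact le_add_of_nonneg_left (Finset.sum_nonneg fun b _ => hnonneg _ _)

/-- After exchanging indices, the total loss is twice the total gain. -/
theorem sum_gain_sub_loss {ι : Type*} [Fintype ι] (R : ι → ι → ι → ℝ) (F : ι → ℝ) :
    ∑ j, (∑ a, ∑ b, (R a b j - 2 * R j b a) * F a * F b) * F j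
      = -∑ j, (∑ a, ∑ b, R a b j * F a * F b) * F j := by
  have hswap : ∑ j, ∑ a, ∑ b, R j b a * F a * F b * F j
      = ∑ j, ∑ a, ∑ b, R a b j * F a * F b * F j := by
    rw [Finset.sum_comm]
    refine Finset.sum_congr rfl fun j _ => Finset.sum_congr rfl fun a _ =>
      Finset.sum_congr rfl fun b _ => by ring
  have hsplit : ∑ j, (∑ a, ∑ b, (R a b j - 2 * R j b a) * F a * F b) * F j
      = ∑ j, ∑ a, ∑ b, R a b j * F a * F b * F j
        - 2 * ∑ j, ∑ a, ∑ b, R j b a * F a * F b * F j := by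
    simp only [Finset.sum_mul, Finset.mul_sum, ← Finset.sum_sub_distrib]
    refine Finset.sum_congr rfl fun j _ => Finset.sum_congr rfl fun a _ =>
      Finset.sum_congr rfl fun b _ => by ring
  rw [hsplit, hswap]
  simp only [Finset.sum_mul]
  ring

/-- Lemma 6.3: in the normal-form setting, with `f_j = |μ_j|²`, `f = f_1 + … + f_K`
and `γ ≤ γ_{ab}^0` for all `a,b ∈ {1,…,K}`:
(i) `f_0' ≥ 2γ f² f_0 + 2 Re(conj(μ_0) g_0)`;
(ii) `f' ≤ −4γ f_0 f² + Σ_{l≥1} 2 Re(conj(μ_l) g_l)`. -/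
theorem stmt16 (K : ℕ) (hK : 1 ≤ K)
    (γ : Fin (K + 1) → Fin (K + 1) → Fin (K + 1) → ℝ)
    (hγnonneg : ∀ a b l, 0 ≤ γ a b l)
    (hγvanish : ∀ a b l : Fin (K + 1), ¬(l < a ∧ l < b) → γ a b l = 0)
    (c : Fin (K + 1) → Fin (K + 1) → ℂ) (hc : ∀ l j, (c l j).re = 0)
    (d : Fin (K + 1) → Fin (K + 1) → Fin (K + 1) → ℂ)
    (hd : ∀ a b j, (d a b j).re =
      (2 - if a = b then (1 : ℝ) else 0) * γ a b j
        - 2 * (2 - if j = b then (1 : ℝ) else 0) * γ j b a)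
    (t : ℝ) (μ : Fin (K + 1) → ℝ → ℂ) (g : Fin (K + 1) → ℂ)
    (hμ : ∀ j, HasDerivAt (μ j)
      ((∑ l, c l j * (‖μ l t‖ : ℂ) ^ 2) * μ j t
        + (∑ a, ∑ b, d a b j * (‖μ a t‖ : ℂ) ^ 2 * (‖μ b t‖ : ℂ) ^ 2) * μ j t + g j) t)
    (γ₀ : ℝ) (hγ₀ : 0 ≤ γ₀)
    (hγ₀le : ∀ a b : Fin K, γ₀ ≤ γ a.succ b.succ 0) :
    2 * γ₀ * (∑ l : Fin K, ‖μ l.succ t‖ ^ 2) ^ 2 * ‖μ 0 t‖ ^ 2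
        + 2 * ((starRingEnd ℂ) (μ 0 t) * g 0).re
      ≤ deriv (fun s => ‖μ 0 s‖ ^ 2) t ∧
    deriv (fun s => ∑ l : Fin K, ‖μ l.succ s‖ ^ 2) t
      ≤ -4 * γ₀ * ‖μ 0 t‖ ^ 2 * (∑ l : Fin K, ‖μ l.succ t‖ ^ 2) ^ 2
        + ∑ l : Fin K, 2 * ((starRingEnd ℂ) (μ l.succ t) * g l.succ).re := by
  set F : Fin (K + 1) → ℝ := fun j => ‖μ j t‖ ^ 2 with hFdef
  set R : Fin (K + 1) → Fin (K + 1) → Fin (K + 1) → ℝ :=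
    fun a b j => (2 - if a = b then (1 : ℝ) else 0) * γ a b j with hRdef
  have hF : ∀ j, 0 ≤ F j := fun j => sq_nonneg _
  have hγR : ∀ a b j, γ a b j ≤ R a b j := fun a b j => by
    have := hγnonneg a b j
    simp only [hRdef]
    split_ifs <;> linarith
  have hR : ∀ a b j, 0 ≤ R a b j := fun a b j => (hγnonneg a b j).trans (hγR a b j)
  have hdR : ∀ a b j, (d a b j).re = R a b j - 2 * R j b a := fun a b j => by
    rw [hd, mul_assoc 2]
  have hR0 : ∀ a b, R 0 b a = 0 := fun a b => by
    simp [hRdef, hγvanish 0 b a fun h => Fin.not_lt_zero _ h.1]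
  have hderiv : ∀ j, HasDerivAt (fun s => ‖μ j s‖ ^ 2)
      (2 * ((∑ a, ∑ b, (R a b j - 2 * R j b a) * F a * F b) * F j)
        + 2 * ((starRingEnd ℂ) (μ j t) * g j).re) t := fun j => by
    have hu : (∑ l, c l j * (‖μ l t‖ : ℂ) ^ 2).re = 0 := by
      rw [Complex.re_sum]
      refine Finset.sum_eq_zero fun l _ => ?_
      rw [← Complex.ofReal_pow, Complex.re_mul_ofReal, hc, zero_mul]
    convert hasDerivAt_norm_sq_of_re_eq_zero hu (hμ j) using 4
    simp only [Complex.re_sum, ← Complex.ofReal_pow, Complex.re_mul_ofReal, hdR, hFdef]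
  have hgain := mul_sq_sum_succ_le (A := fun a b => R a b 0) hF (fun a b => hR a b 0)
    fun a b => (hγ₀le a b).trans (hγR _ _ _)
  have hgain0 := mul_le_mul_of_nonneg_right hgain (hF 0)
  have hzero : ∑ a, ∑ b, (R a b 0 - 2 * R 0 b a) * F a * F b = ∑ a, ∑ b, R a b 0 * F a * F b := by
    simp only [hR0, mul_zero, sub_zero]
  constructor
  · rw [(hderiv 0).deriv, hzero]
    linarith
  · rw [(HasDerivAt.fun_sum fun (l : Fin K) _ => hderiv l.succ).deriv, Finset.sum_add_distrib,
      ← Finset.mul_sum]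
    have hbalance := sum_gain_sub_loss R F
    rw [Fin.sum_univ_succ, Fin.sum_univ_succ (fun j => (∑ a, ∑ b, R a b j * F a * F b) * F j),
      hzero] at hbalance
    have hrest : 0 ≤ ∑ j : Fin K, (∑ a, ∑ b, R a b j.succ * F a * F b) * F j.succ :=
      Finset.sum_nonneg fun j _ => mul_nonneg (Finset.sum_nonneg fun a _ =>
        Finset.sum_nonneg fun b _ => mul_nonneg (mul_nonneg (hR _ _ _) (hF _)) (hF _)) (hF _)
    linarith
end
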